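/- arXiv:2601.19299 — 2 statements merged into one kernel-verified Lean document; each statement's English description precedes it below -/
import Mathlib

section
/- Let p > 1 and γ > 0 be reals, 𝒜 ⊆ ℝ^m a Lebesgue-measurable set, and q : 𝒜 → ℝ measurable. Suppose there exists ψ ∈ ℝ such that the function π*(a) := ((p−1)/(pγ))^{1/(p−1)} · (q(a)+ψ)₊^{1/(p−1)} satisfies ∫_𝒜 π*(a) da = 1, and suppose that a ↦ q(a)π*(a) and a ↦ π*(a)^p are Lebesgue-integrable on 𝒜. Then π* is a probability density on 𝒜, and for every probability density π on 𝒜 such that q·π and π^p are integrable on 𝒜 one has I(π) ≤ I(π*); moreover I(π) = I(π*) if and only if π = π* Lebesgue-almost everywhere on 𝒜. -/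
open MeasureTheory Real

/-- The Tsallis-regularized objective `I(pol)` on the action set `𝒜`. -/
noncomputable def tsallisObjective {m : ℕ} (p γ : ℝ) (𝒜 : Set (Fin m → ℝ))
    (q pol : (Fin m → ℝ) → ℝ) : ℝ :=
  ∫ a in 𝒜, (q a * pol a + γ / (p - 1) * (pol a - pol a ^ p))

/-- Strict tangent-line inequality for `x ↦ x ^ p`, `p > 1`, on the nonnegative reals. -/
lemma rpow_add_mul_sub_lt_rpow {p x y : ℝ} (hp : 1 < p) (hx : 0 ≤ x) (hy : 0 ≤ y)
    (hxy : y ≠ x) : x ^ p + p * x ^ (p - 1) * (y - x) < y ^ p := by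
  rcases hx.eq_or_lt with rfl | hx
  · rw [zero_rpow (by linarith), zero_rpow (by linarith)]
    have : 0 < y := lt_of_le_of_ne hy hxy.symm
    have := rpow_pos_of_pos this p
    linarith
  · have hu : -1 ≤ y / x - 1 := by
      have := div_nonneg hy hx.le
      linarith
    have hu' : y / x - 1 ≠ 0 := by
      rw [sub_ne_zero, Ne, div_eq_one_iff_eq hx.ne']
      exact hxy
    have h := one_add_mul_self_lt_rpow_one_add hu hu' hp
    rw [add_sub_cancel, div_rpow hy hx.le, lt_div_iff₀ (rpow_pos_of_pos hx p)] at h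
    have hxp : x ^ p = x ^ (p - 1) * x := by
      rw [← rpow_add_one hx.ne', sub_add_cancel]
    calc x ^ p + p * x ^ (p - 1) * (y - x) = (1 + p * (y / x - 1)) * x ^ p := by
          rw [hxp]
          field_simp
      _ < y ^ p := h

/-- `t₊ ^ (1/(p-1))`, suitably scaled, is the unique maximizer over `y ≥ 0` of
`t * y - γ / (p - 1) * y ^ p`. -/
lemma mul_sub_rpow_lt_of_ne {p γ t x y : ℝ} (hp : 1 < p) (hγ : 0 < γ)
    (hx : x = ((p - 1) / (p * γ)) ^ (1 / (p - 1)) * (max t 0) ^ (1 / (p - 1)))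
    (hy : 0 ≤ y) (hxy : y ≠ x) :
    t * y - γ / (p - 1) * y ^ p < t * x - γ / (p - 1) * x ^ p := by
  have hp1 : 0 < p - 1 := by linarith
  have hp0 : 0 < p := by linarith
  have hs : 0 ≤ max t 0 := le_max_right _ _
  have hk : 0 ≤ (p - 1) / (p * γ) := by positivity
  have hx0 : 0 ≤ x := by rw [hx]; positivity
  have hxp : x ^ (p - 1) = (p - 1) / (p * γ) * max t 0 := by
    rw [hx, mul_rpow (by positivity) (by positivity), ← rpow_mul hk, ← rpow_mul hs,
      one_div_mul_cancel hp1.ne', rpow_one, rpow_one]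
  have hc : 0 < γ / (p - 1) := by positivity
  have hcx : γ / (p - 1) * (p * x ^ (p - 1)) = max t 0 := by
    rw [hxp]
    field_simp
  have htx : max t 0 * x = t * x := by
    rcases le_total t 0 with h | h
    · have : x = 0 := by
        rw [hx, max_eq_right h, zero_rpow (one_div_pos.2 hp1).ne', mul_zero]
      rw [this, mul_zero, mul_zero]
    · rw [max_eq_left h]
  have hty : t * y ≤ max t 0 * y := mul_le_mul_of_nonneg_right (le_max_left _ _) hy
  have h := mul_lt_mul_of_pos_left (rpow_add_mul_sub_lt_rpow hp hx0 hy hxy) hc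
  have e : γ / (p - 1) * (x ^ p + p * x ^ (p - 1) * (y - x))
      = γ / (p - 1) * x ^ p + max t 0 * y - max t 0 * x := by
    rw [← hcx]
    ring
  rw [e] at h
  linarith

/-- The objective of a density, in terms of the integrand shifted by a multiplier `ψ`. -/
lemma tsallisObjective_eq_integral_sub {m : ℕ} {p γ : ℝ} (ψ : ℝ) {𝒜 : Set (Fin m → ℝ)}
    {q pol : (Fin m → ℝ) → ℝ} (hnorm : ∫ a in 𝒜, pol a = 1)
    (h1 : IntegrableOn (fun a => q a * pol a) 𝒜)
    (h2 : IntegrableOn (fun a => pol a ^ p) 𝒜) :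
    IntegrableOn (fun a => (q a + ψ) * pol a - γ / (p - 1) * pol a ^ p) 𝒜 ∧
    tsallisObjective p γ 𝒜 q pol =
      (∫ a in 𝒜, ((q a + ψ) * pol a - γ / (p - 1) * pol a ^ p)) + (γ / (p - 1) - ψ) := by
  have h0 : IntegrableOn pol 𝒜 := by
    by_contra h
    rw [integral_undef h] at hnorm
    exact zero_ne_one hnorm
  have hF : IntegrableOn (fun a => (q a + ψ) * pol a - γ / (p - 1) * pol a ^ p) 𝒜 := by
    have := (h1.add (h0.const_mul ψ)).sub (h2.const_mul (γ / (p - 1)))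
    refine this.congr (Filter.Eventually.of_forall fun a => ?_)
    simp only [Pi.add_apply, Pi.sub_apply]
    ring
  refine ⟨hF, ?_⟩
  have hc : ∫ a in 𝒜, (γ / (p - 1) - ψ) * pol a = γ / (p - 1) - ψ := by
    rw [integral_const_mul, hnorm, mul_one]
  rw [← hc, ← integral_add hF (h0.const_mul _), tsallisObjective]
  congr 1
  funext a
  ring

/-- The candidate density `π*(a) = ((p−1)/(pγ))^{1/(p−1)} (q(a)+ψ)₊^{1/(p−1)}`, when it
is normalized and the objective is well defined for it, is a probability density on `𝒜`
and is the unique (up to Lebesgue-a.e. equality) maximizer of the Tsallis-regularized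
objective among probability densities on `𝒜` with integrable objective terms. -/
theorem tsallis_optimal_policy {m : ℕ} (p γ : ℝ) (hp : 1 < p) (hγ : 0 < γ)
    (𝒜 : Set (Fin m → ℝ)) (h𝒜 : MeasurableSet 𝒜)
    (q : (Fin m → ℝ) → ℝ) (hq : Measurable q)
    (ψ : ℝ) (pstar : (Fin m → ℝ) → ℝ)
    (hpstar : ∀ a, pstar a
      = ((p - 1) / (p * γ)) ^ (1 / (p - 1)) * (max (q a + ψ) 0) ^ (1 / (p - 1)))
    (hnorm : ∫ a in 𝒜, pstar a = 1)
    (hint1 : IntegrableOn (fun a => q a * pstar a) 𝒜)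
    (hint2 : IntegrableOn (fun a => pstar a ^ p) 𝒜) :
    (Measurable pstar ∧ (∀ a, 0 ≤ pstar a) ∧ (∫ a in 𝒜, pstar a) = 1) ∧
    ∀ pol : (Fin m → ℝ) → ℝ, Measurable pol → (∀ a, 0 ≤ pol a) →
      (∫ a in 𝒜, pol a) = 1 →
      IntegrableOn (fun a => q a * pol a) 𝒜 →
      IntegrableOn (fun a => pol a ^ p) 𝒜 →
      tsallisObjective p γ 𝒜 q pol ≤ tsallisObjective p γ 𝒜 q pstar ∧
      (tsallisObjective p γ 𝒜 q pol = tsallisObjective p γ 𝒜 q pstar ↔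
        pol =ᵐ[volume.restrict 𝒜] pstar) := by
  have hmeas : Measurable pstar := by
    rw [funext hpstar]
    fun_prop
  have hp1 : 0 < p - 1 := by linarith
  have hnonneg : ∀ a, 0 ≤ pstar a := fun a => by
    rw [hpstar]
    positivity
  refine ⟨⟨hmeas, hnonneg, hnorm⟩, fun pol _ hpol hpol1 h1 h2 => ?_⟩
  obtain ⟨hF, hIF⟩ := tsallisObjective_eq_integral_sub (γ := γ) ψ hpol1 h1 h2
  obtain ⟨hG, hIG⟩ := tsallisObjective_eq_integral_sub (γ := γ) ψ hnorm hint1 hint2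
  have hlt : ∀ a, pol a ≠ pstar a →
      (q a + ψ) * pol a - γ / (p - 1) * pol a ^ p
        < (q a + ψ) * pstar a - γ / (p - 1) * pstar a ^ p :=
    fun a ha => mul_sub_rpow_lt_of_ne hp hγ (hpstar a) (hpol a) ha
  have hle : ∀ a, (q a + ψ) * pol a - γ / (p - 1) * pol a ^ p
      ≤ (q a + ψ) * pstar a - γ / (p - 1) * pstar a ^ p := fun a => by
    by_cases ha : pol a = pstar a
    · rw [ha]
    · exact (hlt a ha).le
  rw [hIF, hIG, add_le_add_iff_right, add_left_inj]
  refine ⟨integral_mono hF hG hle, ?_⟩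
  rw [integral_eq_iff_of_ae_le hF hG (Filter.Eventually.of_forall hle)]
  refine Filter.eventually_congr (Filter.Eventually.of_forall fun a => ?_)
  refine ⟨fun h => ?_, fun h => by simp only [h]⟩
  by_contra ha
  exact (hlt a ha).ne h
end

section
/- Let p > 1 and γ > 0 be reals, 𝒜 ⊆ ℝ^m Lebesgue-measurable with 0 < λ(𝒜) < ∞, and q : 𝒜 → ℝ measurable such that a ↦ max(q(a),0)^{1/(p−1)} is Lebesgue-integrable on 𝒜. Then the function F(u) = ∫_𝒜 ((p−1)/(pγ))^{1/(p−1)} (q(a)+u)₊^{1/(p−1)} da satisfies F(u) → 0 as u → −∞ and F(u) → +∞ as u → +∞; consequently there exists a unique ψ ∈ ℝ with F(ψ) = 1. -/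
open MeasureTheory Real Filter

/-- The normalization map `F(u) = ∫_𝒜 ((p−1)/(pγ))^{1/(p−1)} (q(a)+u)₊^{1/(p−1)} da`. -/
noncomputable def normMap {m : ℕ} (p γ : ℝ) (𝒜 : Set (Fin m → ℝ))
    (q : (Fin m → ℝ) → ℝ) (u : ℝ) : ℝ :=
  ∫ a in 𝒜, ((p - 1) / (p * γ)) ^ (1 / (p - 1)) * (max (q a + u) 0) ^ (1 / (p - 1))

section PositivePartPower

variable {α : Type*} [MeasurableSpace α] {μ : Measure α} {q : α → ℝ} {r : ℝ}

theorem rpow_posPart_mono (hr : 0 < r) {x y : ℝ} (h : x ≤ y) :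
    (max x 0) ^ r ≤ (max y 0) ^ r :=
  rpow_le_rpow (le_max_right _ _) (max_le_max_right 0 h) hr.le

theorem measurable_rpow_posPart_add (hq : Measurable q) (u : ℝ) :
    Measurable fun a => (max (q a + u) 0) ^ r :=
  ((hq.add_const u).max measurable_const).pow_const r

theorem integrable_rpow_posPart_add [IsFiniteMeasure μ] (hr : 0 < r) (hq : Measurable q)
    (hint : Integrable (fun a => (max (q a) 0) ^ r) μ) (u : ℝ) :
    Integrable (fun a => (max (q a + u) 0) ^ r) μ := by
  refine ((hint.const_mul (2 ^ r)).add (integrable_const ((2 * |u|) ^ r))).mono'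
    (measurable_rpow_posPart_add hq u).aestronglyMeasurable (ae_of_all _ fun a => ?_)
  rw [norm_of_nonneg (rpow_nonneg (le_max_right _ _) _)]
  have hx : 0 ≤ max (q a) 0 := le_max_right _ _
  have hqx : q a ≤ max (q a) 0 := le_max_left _ _
  have hu : u ≤ |u| := le_abs_self u
  have hu0 : 0 ≤ |u| := abs_nonneg u
  simp only [Pi.add_apply]
  rw [← mul_rpow zero_le_two hx]
  rcases le_total (max (q a) 0) |u| with h | h
  · have : (max (q a + u) 0) ^ r ≤ (2 * |u|) ^ r :=
      rpow_le_rpow (le_max_right _ _) (max_le (by linarith) (by linarith)) hr.le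
    have : 0 ≤ (2 * max (q a) 0) ^ r := by positivity
    linarith
  · have : (max (q a + u) 0) ^ r ≤ (2 * max (q a) 0) ^ r :=
      rpow_le_rpow (le_max_right _ _) (max_le (by linarith) (by linarith)) hr.le
    have : 0 ≤ (2 * |u|) ^ r := by positivity
    linarith

theorem continuous_integral_rpow_posPart_add [IsFiniteMeasure μ] (hr : 0 < r)
    (hq : Measurable q) (hint : Integrable (fun a => (max (q a) 0) ^ r) μ) :
    Continuous fun u => ∫ a, (max (q a + u) 0) ^ r ∂μ := by
  refine continuous_iff_continuousAt.2 fun u₀ => ?_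
  refine continuousAt_of_dominated (bound := fun a => (max (q a + (u₀ + 1)) 0) ^ r)
    (Eventually.of_forall fun u => (measurable_rpow_posPart_add hq u).aestronglyMeasurable)
    ?_ (integrable_rpow_posPart_add hr hq hint _) (ae_of_all _ fun a => ?_)
  · filter_upwards [Iio_mem_nhds (lt_add_one u₀)] with u hu
    refine ae_of_all _ fun a => ?_
    rw [norm_of_nonneg (rpow_nonneg (le_max_right _ _) _)]
    exact rpow_posPart_mono hr (by linarith [Set.mem_Iio.1 hu])
  · exact (((continuous_const.add continuous_id).max continuous_const).rpow_const
      fun _ => Or.inr hr.le).continuousAt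

theorem tendsto_integral_rpow_posPart_add_atBot (hr : 0 < r)
    (hq : Measurable q) (hint : Integrable (fun a => (max (q a) 0) ^ r) μ) :
    Tendsto (fun u => ∫ a, (max (q a + u) 0) ^ r ∂μ) atBot (nhds 0) := by
  suffices Tendsto (fun u => ∫ a, (max (q a + u) 0) ^ r ∂μ) atBot (nhds (∫ _, 0 ∂μ)) by
    simpa using this
  refine tendsto_integral_filter_of_dominated_convergence _
    (Eventually.of_forall fun u => (measurable_rpow_posPart_add hq u).aestronglyMeasurable)
    ?_ hint (ae_of_all _ fun a => ?_)
  · filter_upwards [eventually_le_atBot 0] with u hu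
    refine ae_of_all _ fun a => ?_
    rw [norm_of_nonneg (rpow_nonneg (le_max_right _ _) _)]
    exact rpow_posPart_mono hr (by linarith)
  · refine tendsto_const_nhds.congr' ?_
    filter_upwards [eventually_le_atBot (-q a)] with u hu
    rw [max_eq_right (by linarith), zero_rpow hr.ne']

theorem tendsto_integral_rpow_posPart_add_atTop [IsFiniteMeasure μ] [NeZero μ] (hr : 0 < r)
    (hq : Measurable q) (hint : Integrable (fun a => (max (q a) 0) ^ r) μ) :
    Tendsto (fun u => ∫ a, (max (q a + u) 0) ^ r ∂μ) atTop atTop := by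
  obtain ⟨n, hn⟩ : ∃ n : ℕ, μ {a | -(n : ℝ) ≤ q a} ≠ 0 := by
    by_contra! h
    refine NeZero.ne μ (Measure.measure_univ_eq_zero.1 ?_)
    refine measure_mono_null (fun a _ => ?_) (measure_iUnion_null h)
    obtain ⟨n, hn⟩ := exists_nat_ge (-q a)
    exact Set.mem_iUnion.2 ⟨n, show -(n : ℝ) ≤ q a by linarith⟩
  have hpos : 0 < μ.real {a | -(n : ℝ) ≤ q a} :=
    ENNReal.toReal_pos hn (measure_ne_top _ _)
  have hlim : Tendsto (fun u : ℝ => (u - n) ^ r * μ.real {a | -(n : ℝ) ≤ q a}) atTop atTop :=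
    ((tendsto_rpow_atTop hr).comp (tendsto_atTop_add_const_right _ (-(n : ℝ))
      tendsto_id)).atTop_mul_const hpos
  refine tendsto_atTop_mono' _ ?_ hlim
  filter_upwards [eventually_ge_atTop (n : ℝ)] with u hu
  refine le_trans ?_ (mul_meas_ge_le_integral_of_nonneg
    (ae_of_all _ fun a => rpow_nonneg (le_max_right _ _) _)
    (integrable_rpow_posPart_add hr hq hint u) ((u - n) ^ r))
  refine mul_le_mul_of_nonneg_left (measureReal_mono fun a ha => ?_)
    (rpow_nonneg (by linarith) _)
  have ha' : -(n : ℝ) ≤ q a := ha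
  exact rpow_le_rpow (by linarith) (le_max_of_le_left (by linarith)) hr.le

theorem integral_rpow_posPart_add_lt [IsFiniteMeasure μ] (hr : 0 < r)
    (hq : Measurable q) (hint : Integrable (fun a => (max (q a) 0) ^ r) μ) {u v : ℝ}
    (huv : u < v) (hu : ∫ a, (max (q a + u) 0) ^ r ∂μ ≠ 0) :
    ∫ a, (max (q a + u) 0) ^ r ∂μ < ∫ a, (max (q a + v) 0) ^ r ∂μ := by
  have hle : ∀ a, (max (q a + u) 0) ^ r ≤ (max (q a + v) 0) ^ r :=
    fun a => rpow_posPart_mono hr (by linarith)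
  have hiu := integrable_rpow_posPart_add hr hq hint u
  have hiv := integrable_rpow_posPart_add hr hq hint v
  refine lt_of_le_of_ne (integral_mono hiu hiv hle) fun heq => hu ?_
  have hae := (integral_eq_iff_of_ae_le hiu hiv (ae_of_all _ hle)).1 heq
  refine integral_eq_zero_of_ae ?_
  filter_upwards [hae] with a ha
  rcases le_or_gt (q a + u) 0 with h | h
  · simp [max_eq_right h, zero_rpow hr.ne']
  · rw [max_eq_left h.le, max_eq_left (by linarith)] at ha
    exact absurd ha (rpow_lt_rpow h.le (by linarith) hr).ne

end PositivePartPower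

/-- For `p > 1`, `γ > 0`, `𝒜` measurable of positive finite Lebesgue measure and `q`
measurable with `(q)₊^{1/(p−1)}` integrable on `𝒜`, the normalization map `F` satisfies
`F(u) → 0` as `u → −∞` and `F(u) → +∞` as `u → +∞`; consequently there exists a unique
`ψ ∈ ℝ` with `F(ψ) = 1`. -/
theorem normMap_limits_and_normalizer {m : ℕ} (p γ : ℝ) (hp : 1 < p) (hγ : 0 < γ)
    (𝒜 : Set (Fin m → ℝ)) (h𝒜 : MeasurableSet 𝒜)
    (h𝒜pos : 0 < volume 𝒜) (h𝒜fin : volume 𝒜 < ⊤)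
    (q : (Fin m → ℝ) → ℝ) (hq : Measurable q)
    (hqint : IntegrableOn (fun a => (max (q a) 0) ^ (1 / (p - 1))) 𝒜) :
    Tendsto (normMap p γ 𝒜 q) atBot (nhds 0) ∧
    Tendsto (normMap p γ 𝒜 q) atTop atTop ∧
    ∃! ψ : ℝ, normMap p γ 𝒜 q ψ = 1 := by
  have hr : 0 < 1 / (p - 1) := one_div_pos.2 (sub_pos.2 hp)
  have hc : 0 < ((p - 1) / (p * γ)) ^ (1 / (p - 1)) :=
    rpow_pos_of_pos (div_pos (sub_pos.2 hp) (mul_pos (by linarith) hγ)) _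
  have : IsFiniteMeasure (volume.restrict 𝒜) := ⟨by simpa using h𝒜fin⟩
  have : NeZero (volume.restrict 𝒜) := ⟨by simpa using h𝒜pos.ne'⟩
  have hF : normMap p γ 𝒜 q = fun u => ((p - 1) / (p * γ)) ^ (1 / (p - 1)) *
      ∫ a in 𝒜, (max (q a + u) 0) ^ (1 / (p - 1)) :=
    funext fun u => integral_const_mul _ _
  have hcont : Continuous (normMap p γ 𝒜 q) :=
    hF ▸ continuous_const.mul (continuous_integral_rpow_posPart_add hr hq hqint)
  have hbot : Tendsto (normMap p γ 𝒜 q) atBot (nhds 0) := by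
    simpa [hF] using (tendsto_integral_rpow_posPart_add_atBot hr hq hqint).const_mul
      (((p - 1) / (p * γ)) ^ (1 / (p - 1)))
  have htop : Tendsto (normMap p γ 𝒜 q) atTop atTop :=
    hF ▸ (tendsto_integral_rpow_posPart_add_atTop hr hq hqint).const_mul_atTop hc
  have hlt : ∀ u v, u < v → normMap p γ 𝒜 q u = 1 → 1 < normMap p γ 𝒜 q v := by
    intro u v huv hu
    rw [← hu]
    simp only [hF] at hu ⊢
    exact mul_lt_mul_of_pos_left (integral_rpow_posPart_add_lt hr hq hqint huv
      fun h => zero_ne_one ((mul_eq_zero_of_right _ h).symm.trans hu)) hc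
  refine ⟨hbot, htop, ?_⟩
  obtain ⟨ψ, hψ⟩ := mem_range_of_exists_le_of_exists_ge hcont
    (hbot.eventually_le_const zero_lt_one).exists (htop.eventually_ge_atTop 1).exists
  refine ⟨ψ, hψ, fun φ hφ => ?_⟩
  rcases lt_trichotomy φ ψ with h | h | h
  · exact absurd hψ (hlt φ ψ h hφ).ne'
  · exact h
  · exact absurd hφ (hlt ψ φ h hψ).ne'
end
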